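/- Let R1 and R2 be relations over attribute sets U1 and U2, F1 a filter over U1, and F a filter over U1 ∪ U2. Then σ_{F1} R1 ⟕_F R2 ≡ σ_{F1}(R1 ⟕_F R2). -/

import Mathlib

noncomputable section
open Classical

attribute [local instance 10] Classical.propDecidable

namespace RA

variable {A Δ : Type} [DecidableEq A] [DecidableEq Δ]

/-- Three-valued logic: true, false, unknown (error). -/
inductive TV where
  | tt | ff | unk
deriving DecidableEq

/-- Kleene conjunction. -/
def TV.and : TV → TV → TV
  | .ff, _ => .ff
  | _, .ff => .ff
  | .tt, .tt => .tt
  | _, _ => .unk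

/-- Kleene negation. -/
def TV.not : TV → TV
  | .tt => .ff
  | .ff => .tt
  | .unk => .unk

mutual
/-- Terms over attributes `A` and domain `Δ`: attributes, constants and conditionals. -/
inductive Term (A Δ : Type) where
  | attr : A → Term A Δ
  | const : Δ → Term A Δ
  | ite : Filter A Δ → Term A Δ → Term A Δ → Term A Δ

/-- RA filters: `isNull` on a (finite) set of terms, equality, conjunction, negation. -/
inductive Filter (A Δ : Type) where
  | isNull : List (Term A Δ) → Filter A Δ
  | eq : Term A Δ → Term A Δ → Filter A Δ
  | and : Filter A Δ → Filter A Δ → Filter A Δ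
  | not : Filter A Δ → Filter A Δ
end

/-- Disjunction: `F1 ∨ F2 = ¬(¬F1 ∧ ¬F2)`. -/
def Filter.or (F1 F2 : Filter A Δ) : Filter A Δ := .not ((Filter.not F1).and (Filter.not F2))

/-- The tautological filter ⊤ (`isNull` of the empty set of terms is always true). -/
def Filter.tru : Filter A Δ := .isNull []

/-- A tuple over a set of attributes: `none` marks attributes outside the set. -/
abbrev Tuple (A Δ : Type) := A → Option Δ

mutual
/-- Evaluation of a term on a tuple (`null` is the distinguished null value of `Δ`). -/
def Term.eval (null : Δ) (t : Tuple A Δ) : Term A Δ → Δ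
  | .attr a => (t a).getD null
  | .const c => c
  | .ite F v v' => if F.eval null t = TV.tt then v.eval null t else v'.eval null t

def Term.evalList (null : Δ) (t : Tuple A Δ) : List (Term A Δ) → List Δ
  | [] => []
  | v :: vs => v.eval null t :: Term.evalList null t vs

/-- Three-valued evaluation of a filter on a tuple. -/
def Filter.eval (null : Δ) (t : Tuple A Δ) : Filter A Δ → TV
  | .isNull V => if ∀ d ∈ Term.evalList null t V, d = null then .tt else .ff
  | .eq v v' =>
      if v.eval null t = null ∨ v'.eval null t = null then .unk
      else if v.eval null t = v'.eval null t then .tt else .ff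
  | .and F1 F2 => (F1.eval null t).and (F2.eval null t)
  | .not F => (F.eval null t).not
end

mutual
/-- Attributes occurring in a term. -/
def Term.attrs : Term A Δ → Finset A
  | .attr a => {a}
  | .const _ => ∅
  | .ite F v v' => F.attrs ∪ v.attrs ∪ v'.attrs

def Term.attrsList : List (Term A Δ) → Finset A
  | [] => ∅
  | v :: vs => v.attrs ∪ Term.attrsList vs

/-- Attributes occurring in a filter. -/
def Filter.attrs : Filter A Δ → Finset A
  | .isNull V => Term.attrsList V
  | .eq v v' => v.attrs ∪ v'.attrs
  | .and F1 F2 => F1.attrs ∪ F2.attrs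
  | .not F => F.attrs
end

/-- A term is over `U` if all its attributes are in `U`. -/
def Term.over (v : Term A Δ) (U : Finset A) : Prop := v.attrs ⊆ U

/-- A filter is over `U` if all its attributes are in `U`. -/
def Filter.over (F : Filter A Δ) (U : Finset A) : Prop := F.attrs ⊆ U

/-- A tuple is over `U` if its domain is exactly `U`. -/
def Tuple.isOver (t : Tuple A Δ) (U : Finset A) : Prop := ∀ a, (t a).isSome ↔ a ∈ U

/-- A relation is a bag (multiset) of tuples. -/
abbrev Rel (A Δ : Type) := Multiset (Tuple A Δ)

/-- A relation is over `U` if all its tuples are. -/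
def Rel.isOver (R : Rel A Δ) (U : Finset A) : Prop := ∀ t ∈ R, t.isOver U

/-- Selection σ_F. -/
def select (null : Δ) (F : Filter A Δ) (R : Rel A Δ) : Rel A Δ :=
  R.filter (fun t => F.eval null t = .tt)

/-- Restriction of a tuple to the attributes in `U`. -/
def Tuple.restrict (t : Tuple A Δ) (U : Finset A) : Tuple A Δ :=
  fun a => if a ∈ U then t a else none

/-- Projection π_U (bag semantics: multiplicities are added up). -/
def proj (U : Finset A) (R : Rel A Δ) : Rel A Δ := R.map (·.restrict U)

/-- Bag difference: `(R1 ∖ R2)(t) = R1(t)` if `t ∉ R2` and `0` otherwise. -/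
def bdiff (R1 R2 : Rel A Δ) : Rel A Δ := R1.filter (fun t => t ∉ R2)

/-- Compatibility of tuples: equal and non-null on the shared attributes. -/
def Compat (null : Δ) (t1 t2 : Tuple A Δ) : Prop :=
  ∀ a, (t1 a).isSome → (t2 a).isSome → (t1 a = t2 a ∧ t1 a ≠ some null)

/-- `t1 ⊕ t2`: the common extension of two (compatible) tuples. -/
def Tuple.merge (t1 t2 : Tuple A Δ) : Tuple A Δ :=
  fun a => (t1 a).or (t2 a)

/-- Natural join. -/
def join (null : Δ) (R1 R2 : Rel A Δ) : Rel A Δ :=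
  (R1.product R2).filterMap
    (fun p => if Compat null p.1 p.2 then some (p.1.merge p.2) else none)

/-- Natural join with a filter: `R1 ⋈_F R2 = σ_F (R1 ⋈ R2)`. -/
def joinF (null : Δ) (F : Filter A Δ) (R1 R2 : Rel A Δ) : Rel A Δ :=
  select null F (join null R1 R2)

/-- Padding of a tuple with `null` on the attributes of `V`. -/
def Tuple.pad (null : Δ) (V : Finset A) (t : Tuple A Δ) : Tuple A Δ :=
  fun a => if a ∈ V then (t a).or (some null) else t a

/-- Outer union of `R1` over `U1` and `R2` over `U2`:
each relation is padded with nulls on the attributes missing from it. -/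
def ounion (null : Δ) (U1 U2 : Finset A) (R1 R2 : Rel A Δ) : Rel A Δ :=
  R1.map (Tuple.pad null (U2 \ U1)) + R2.map (Tuple.pad null (U1 \ U2))

/-- Left join `R1 ⟕_F R2 = (R1 ⋈_F R2) ⊎ (R1 ∖ π_{U1}(R1 ⋈_F R2))`
for `R1` over `U1` and `R2` over `U2`. -/
def ljoin (null : Δ) (U1 U2 : Finset A) (F : Filter A Δ) (R1 R2 : Rel A Δ) : Rel A Δ :=
  ounion null (U1 ∪ U2) U1 (joinF null F R1 R2) (bdiff R1 (proj U1 (joinF null F R1 R2)))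

/-- Natural left join `R1 ⟕ R2 = R1 ⟕_⊤ R2`. -/
def nljoin (null : Δ) (U1 U2 : Finset A) (R1 R2 : Rel A Δ) : Rel A Δ :=
  ljoin null U1 U2 Filter.tru R1 R2

/-- Extension ν_{u↦v}. -/
def extend (null : Δ) (u : A) (v : Term A Δ) (R : Rel A Δ) : Rel A Δ :=
  R.map (fun t a => if a = u then some (v.eval null t) else t a)

/-- Duplicate elimination δ. -/
def dedup (R : Rel A Δ) : Rel A Δ := R.dedup

/-- Extended renaming ρ^V_{{u/f(u) | u ∈ S}} at the level of tuples:
each attribute `u ∈ S` receives the value of the term `f u` (evaluated on the original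
tuple) and the attributes of `V ∖ S` are projected away. -/
def renameFun (null : Δ) (V S : Finset A) (f : A → Term A Δ) (t : Tuple A Δ) : Tuple A Δ :=
  fun a => if a ∈ S then some ((f a).eval null t) else if a ∈ V then none else t a

/-- Extended renaming ρ^V_{{u/f(u) | u ∈ S}}. -/
def rename (null : Δ) (V S : Finset A) (f : A → Term A Δ) (R : Rel A Δ) : Rel A Δ :=
  R.map (renameFun null V S f)

/-- Renaming of the attribute `uold` into `unew` at the level of tuples. -/
def renameAttrT (unew uold : A) (t : Tuple A Δ) : Tuple A Δ :=
  fun a => if a = unew then t uold else if a = uold then none else t a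

/-- `R[unew/uold]`: the relation `R` with the attribute `uold` renamed to `unew`. -/
def renameAttr (unew uold : A) (R : Rel A Δ) : Rel A Δ := R.map (renameAttrT unew uold)

/-- `coalesce(v, v') = if(¬isNull(v), v, v')`. -/
def Term.coalesce (v v' : Term A Δ) : Term A Δ := .ite (.not (.isNull [v])) v v'

/-- The filter `⋀_{u ∈ K} ¬isNull(u)`. -/
def notNullAll (K : Finset A) : Filter A Δ :=
  K.toList.foldr (fun u acc => (Filter.not (.isNull [.attr u])).and acc) Filter.tru

mutual
/-- `nullify_S`: replace every occurrence of an attribute from `S` by the constant null. -/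
def Term.nullify (null : Δ) (S : Finset A) : Term A Δ → Term A Δ
  | .attr a => if a ∈ S then .const null else .attr a
  | .const c => .const c
  | .ite F v v' => .ite (F.nullify null S) (v.nullify null S) (v'.nullify null S)

def Term.nullifyList (null : Δ) (S : Finset A) : List (Term A Δ) → List (Term A Δ)
  | [] => []
  | v :: vs => v.nullify null S :: Term.nullifyList null S vs

/-- `nullify_S` on filters. -/
def Filter.nullify (null : Δ) (S : Finset A) : Filter A Δ → Filter A Δ
  | .isNull V => .isNull (Term.nullifyList null S V)
  | .eq v v' => .eq (v.nullify null S) (v'.nullify null S)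
  | .and F1 F2 => .and (F1.nullify null S) (F2.nullify null S)
  | .not F => .not (F.nullify null S)
end

/-- p-equivalence of filters over `U`: they are ⊤ on the same tuples over `U`. -/
def pequiv (null : Δ) (U : Finset A) (F1 F2 : Filter A Δ) : Prop :=
  ∀ t : Tuple A Δ, t.isOver U → (F1.eval null t = TV.tt ↔ F2.eval null t = TV.tt)

end RA

namespace RA

variable {A Δ : Type} [DecidableEq A] [DecidableEq Δ]

mutual
/-- The value of a term depends only on the values of its attributes. -/
theorem Term.eval_congr (null : Δ) (t s : Tuple A Δ) : (v : Term A Δ) →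
    (∀ a ∈ v.attrs, (t a).getD null = (s a).getD null) → v.eval null t = v.eval null s
  | .attr a, h => by
      simp only [Term.eval]
      exact h a (by simp [Term.attrs])
  | .const _, _ => by simp only [Term.eval]
  | .ite F v v', h => by
      simp only [Term.attrs, Finset.mem_union] at h
      simp only [Term.eval]
      rw [Filter.eval_congr null t s F fun a ha => h a (.inl (.inl ha)),
        Term.eval_congr null t s v fun a ha => h a (.inl (.inr ha)),
        Term.eval_congr null t s v' fun a ha => h a (.inr ha)]

/-- The values of a list of terms depend only on the values of their attributes. -/
theorem Term.evalList_congr (null : Δ) (t s : Tuple A Δ) : (V : List (Term A Δ)) →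
    (∀ a ∈ Term.attrsList V, (t a).getD null = (s a).getD null) →
    Term.evalList null t V = Term.evalList null s V
  | [], _ => by simp only [Term.evalList]
  | v :: vs, h => by
      simp only [Term.attrsList, Finset.mem_union] at h
      simp only [Term.evalList]
      rw [Term.eval_congr null t s v fun a ha => h a (.inl ha),
        Term.evalList_congr null t s vs fun a ha => h a (.inr ha)]

/-- The truth value of a filter depends only on the values of its attributes. -/
theorem Filter.eval_congr (null : Δ) (t s : Tuple A Δ) : (F : Filter A Δ) →
    (∀ a ∈ F.attrs, (t a).getD null = (s a).getD null) → F.eval null t = F.eval null s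
  | .isNull V, h => by
      simp only [Filter.attrs] at h
      simp only [Filter.eval]
      rw [Term.evalList_congr null t s V h]
  | .eq v v', h => by
      simp only [Filter.attrs, Finset.mem_union] at h
      simp only [Filter.eval]
      rw [Term.eval_congr null t s v fun a ha => h a (.inl ha),
        Term.eval_congr null t s v' fun a ha => h a (.inr ha)]
  | .and F1 F2, h => by
      simp only [Filter.attrs, Finset.mem_union] at h
      simp only [Filter.eval]
      rw [Filter.eval_congr null t s F1 fun a ha => h a (.inl ha),
        Filter.eval_congr null t s F2 fun a ha => h a (.inr ha)]
  | .not F, h => by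
      simp only [Filter.attrs] at h
      simp only [Filter.eval]
      rw [Filter.eval_congr null t s F h]
end

theorem Filter.eval_pad (null : Δ) (V : Finset A) (t : Tuple A Δ) (F : Filter A Δ) :
    F.eval null (t.pad null V) = F.eval null t := by
  refine Filter.eval_congr null _ _ F fun a _ => ?_
  unfold Tuple.pad
  split_ifs
  · cases t a <;> rfl
  · rfl

theorem Filter.eval_restrict (null : Δ) {U : Finset A} (t : Tuple A Δ) {F : Filter A Δ}
    (hF : F.over U) : F.eval null (t.restrict U) = F.eval null t :=
  Filter.eval_congr null _ _ F fun a ha => by simp [Tuple.restrict, hF ha]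

theorem Filter.eval_merge (null : Δ) {U : Finset A} {t : Tuple A Δ} (s : Tuple A Δ)
    {F : Filter A Δ} (hF : F.over U) (ht : t.isOver U) :
    F.eval null (t.merge s) = F.eval null t := by
  refine Filter.eval_congr null _ _ F fun a ha => ?_
  obtain ⟨d, hd⟩ := Option.isSome_iff_exists.mp ((ht a).mpr (hF ha))
  simp [Tuple.merge, hd]

omit [DecidableEq A] in
theorem select_comm (null : Δ) (F G : Filter A Δ) (R : Rel A Δ) :
    select null F (select null G R) = select null G (select null F R) :=
  Multiset.filter_comm _ _ _

theorem select_map_pad (null : Δ) (F : Filter A Δ) (V : Finset A) (R : Rel A Δ) :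
    select null F (R.map (Tuple.pad null V)) = (select null F R).map (Tuple.pad null V) := by
  simp only [select, Multiset.filter_map, Function.comp_def, Filter.eval_pad]

theorem select_ounion (null : Δ) (F : Filter A Δ) (U1 U2 : Finset A) (R1 R2 : Rel A Δ) :
    select null F (ounion null U1 U2 R1 R2)
      = ounion null U1 U2 (select null F R1) (select null F R2) := by
  simp only [ounion, ← select_map_pad]
  exact Multiset.filter_add _ _ _

omit [DecidableEq A] [DecidableEq Δ] in
theorem join_cons (null : Δ) (t : Tuple A Δ) (R1 R2 : Rel A Δ) :
    join null (t ::ₘ R1) R2 =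
      (R2.filterMap fun s => if Compat null t s then some (t.merge s) else none)
        + join null R1 R2 := by
  have h : (t ::ₘ R1).product R2 = R2.map (Prod.mk t) + R1.product R2 :=
    Multiset.cons_product t R1 R2
  rw [join, h, Multiset.filterMap_add, Multiset.filterMap_map]
  rfl

/-- A filter over the attributes of the left operand can be pushed into a natural join. -/
theorem join_select (null : Δ) {U : Finset A} {R1 : Rel A Δ} (R2 : Rel A Δ) {F : Filter A Δ}
    (hR1 : R1.isOver U) (hF : F.over U) :
    join null (select null F R1) R2 = select null F (join null R1 R2) := by
  induction R1 using Multiset.induction_on with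
  | empty =>
    have h : join null 0 R2 = 0 := by
      rw [join, show Multiset.product 0 R2 = 0 from Multiset.zero_product R2,
        Multiset.filterMap_zero]
    have hsel : select null F (0 : Rel A Δ) = 0 := Multiset.filter_zero _
    rw [hsel, h, hsel]
  | cons t R ih =>
    have ih := ih fun s hs => hR1 s (Multiset.mem_cons_of_mem hs)
    have ht : t.isOver U := hR1 t (Multiset.mem_cons_self t R)
    have select_add : ∀ S T : Rel A Δ, select null F (S + T) = select null F S + select null F T :=
      Multiset.filter_add _
    have eval_of_mem : ∀ u ∈ R2.filterMap fun s =>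
        if Compat null t s then some (t.merge s) else none, F.eval null u = F.eval null t := by
      intro u hu
      obtain ⟨s, -, hs⟩ := (Multiset.mem_filterMap _ _).mp hu
      split_ifs at hs
      rw [← Option.some.inj hs, Filter.eval_merge null s hF ht]
    rw [join_cons, select_add, ← ih]
    by_cases h : F.eval null t = .tt
    · have hsel : select null F (t ::ₘ R) = t ::ₘ select null F R :=
        Multiset.filter_cons_of_pos R h
      rw [hsel, join_cons]
      congr 1
      exact (Multiset.filter_eq_self.mpr fun u hu => (eval_of_mem u hu).trans h).symm
    · have hsel : select null F (t ::ₘ R) = select null F R :=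
        Multiset.filter_cons_of_neg R h
      rw [hsel]
      refine (zero_add _).symm.trans (congrArg (· + _) ?_)
      exact (Multiset.filter_eq_nil.mpr fun u hu hu' => h ((eval_of_mem u hu).symm.trans hu')).symm

theorem joinF_select (null : Δ) {U : Finset A} {R1 : Rel A Δ} (R2 : Rel A Δ)
    {F1 : Filter A Δ} (F : Filter A Δ) (hR1 : R1.isOver U) (hF1 : F1.over U) :
    joinF null F (select null F1 R1) R2 = select null F1 (joinF null F R1 R2) := by
  rw [joinF, join_select null R2 hR1 hF1, select_comm, joinF]

theorem bdiff_select_proj (null : Δ) {U : Finset A} (R S : Rel A Δ) {F : Filter A Δ}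
    (hF : F.over U) :
    bdiff (select null F R) (proj U (select null F S)) = select null F (bdiff R (proj U S)) := by
  unfold select bdiff
  rw [Multiset.filter_comm, Multiset.filter_filter, Multiset.filter_filter]
  refine Multiset.filter_congr fun t _ => and_congr_right fun ht => not_congr ?_
  simp only [proj, Multiset.mem_map, Multiset.mem_filter]
  constructor
  · rintro ⟨s, ⟨hs, -⟩, rfl⟩
    exact ⟨s, hs, rfl⟩
  · rintro ⟨s, hs, rfl⟩
    exact ⟨s, ⟨hs, Filter.eval_restrict null s hF ▸ ht⟩, rfl⟩

theorem stmt1 (null : Δ) (U1 U2 : Finset A) (R1 R2 : Rel A Δ) (F1 F : Filter A Δ)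
    (hR1 : R1.isOver U1) (hR2 : R2.isOver U2)
    (hF1 : F1.over U1) (hF : F.over (U1 ∪ U2)) :
    ljoin null U1 U2 F (select null F1 R1) R2
      = select null F1 (ljoin null U1 U2 F R1 R2) := by
  rw [ljoin, joinF_select null R2 F hR1 hF1, bdiff_select_proj null R1 _ hF1, ← select_ounion,
    ljoin]

end RA
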